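/- arXiv:2502.18839 — 3 statements merged into one kernel-verified Lean document; each statement's English description precedes it below -/
import Mathlib

section
/- Let λ, β ∈ ℝ^{n_d} and γ ∈ ℝ^{n_s} be nonnegative with λ_i + ρβ_i > 0 for every i, let 0 ≤ α < 1, and let 0 < ρ ≤ (1−α)/(2−α). Let x be a v-optimal solution and (a,b) a v-optimal dual for (λ+ρβ, γ), and set v̄_i = (Σ_j v_{i,j} x_{i,j})/(λ_i+ρβ_i). Define the global treatment effect Δ = (1−α)Φ_v(λ+β,γ) − Φ_v(λ,γ), the RCT estimator Δ̂_RCT = (1−α)·Σ_i v̄_i(λ_i+β_i) − Σ_i v̄_i λ_i, and the shadow price estimator Δ̂_SP = a·β − α·(a·(λ+β) + b·γ). Then the shadow price estimator reduces bias: |Δ̂_SP − Δ| ≤ Δ̂_RCT − Δ. -/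
/-- A matrix `x` is CE-feasible for demand `d` and supply `s`. -/
def CEfeasible {nd ns : ℕ} (d : Fin nd → ℝ) (s : Fin ns → ℝ)
    (x : Fin nd → Fin ns → ℝ) : Prop :=
  (∀ i j, 0 ≤ x i j) ∧ (∀ i, ∑ j, x i j ≤ d i) ∧ (∀ j, ∑ i, x i j ≤ s j)

/-- The cost-excluded matching value `Φ_w(d,s)`. -/
noncomputable def Phi {nd ns : ℕ} (w : Fin nd → Fin ns → ℝ)
    (d : Fin nd → ℝ) (s : Fin ns → ℝ) : ℝ :=
  sSup {z : ℝ | ∃ x, CEfeasible d s x ∧ z = ∑ i, ∑ j, w i j * x i j}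

/-- `x` is a `w`-optimal solution for `(d,s)`. -/
def IsOptimal {nd ns : ℕ} (w : Fin nd → Fin ns → ℝ)
    (d : Fin nd → ℝ) (s : Fin ns → ℝ) (x : Fin nd → Fin ns → ℝ) : Prop :=
  CEfeasible d s x ∧ ∑ i, ∑ j, w i j * x i j = Phi w d s

/-- `(a,b)` is a `w`-optimal dual for `(d,s)`. -/
def IsOptimalDual {nd ns : ℕ} (w : Fin nd → Fin ns → ℝ)
    (d : Fin nd → ℝ) (s : Fin ns → ℝ) (a : Fin nd → ℝ) (b : Fin ns → ℝ) : Prop :=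
  (∀ i, 0 ≤ a i) ∧ (∀ j, 0 ≤ b j) ∧ (∀ i j, w i j ≤ a i + b j) ∧
  (∑ i, a i * d i) + (∑ j, b j * s j) = Phi w d s

/-- Row sums of a feasible solution are priced by the dual variables. -/
theorem row_value_le_dual {nd ns : ℕ} {w : Fin nd → Fin ns → ℝ} {d : Fin nd → ℝ}
    {s : Fin ns → ℝ} {x : Fin nd → Fin ns → ℝ} {a : Fin nd → ℝ} {b : Fin ns → ℝ}
    (hx : CEfeasible d s x) (ha : ∀ i, 0 ≤ a i) (hw : ∀ i j, w i j ≤ a i + b j) (i : Fin nd) :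
    ∑ j, w i j * x i j ≤ a i * d i + ∑ j, b j * x i j := by
  calc ∑ j, w i j * x i j ≤ ∑ j, (a i + b j) * x i j :=
        Finset.sum_le_sum fun j _ => mul_le_mul_of_nonneg_right (hw i j) (hx.1 i j)
    _ = a i * ∑ j, x i j + ∑ j, b j * x i j := by
        simp only [add_mul, Finset.sum_add_distrib, Finset.mul_sum]
    _ ≤ a i * d i + ∑ j, b j * x i j := by
        gcongr
        · exact ha i
        · exact hx.2.1 i

theorem sum_supply_price_le {nd ns : ℕ} {d : Fin nd → ℝ} {s : Fin ns → ℝ}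
    {x : Fin nd → Fin ns → ℝ} {b : Fin ns → ℝ} (hx : CEfeasible d s x) (hb : ∀ j, 0 ≤ b j) :
    ∑ i, ∑ j, b j * x i j ≤ ∑ j, b j * s j := by
  rw [Finset.sum_comm]
  refine Finset.sum_le_sum fun j _ => ?_
  rw [← Finset.mul_sum]
  exact mul_le_mul_of_nonneg_left (hx.2.2 j) (hb j)

/-- Weak duality for a feasible solution. -/
theorem value_le_dual {nd ns : ℕ} {w : Fin nd → Fin ns → ℝ} {d : Fin nd → ℝ}
    {s : Fin ns → ℝ} {x : Fin nd → Fin ns → ℝ} {a : Fin nd → ℝ} {b : Fin ns → ℝ}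
    (hx : CEfeasible d s x) (ha : ∀ i, 0 ≤ a i) (hb : ∀ j, 0 ≤ b j)
    (hw : ∀ i j, w i j ≤ a i + b j) :
    ∑ i, ∑ j, w i j * x i j ≤ (∑ i, a i * d i) + ∑ j, b j * s j := by
  have h := Finset.sum_le_sum fun i (_ : i ∈ Finset.univ) => row_value_le_dual hx ha hw i
  rw [Finset.sum_add_distrib] at h
  linarith [sum_supply_price_le hx hb]

theorem Phi_le_dual {nd ns : ℕ} {w : Fin nd → Fin ns → ℝ} {d : Fin nd → ℝ}
    {s : Fin ns → ℝ} {a : Fin nd → ℝ} {b : Fin ns → ℝ}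
    (hd : ∀ i, 0 ≤ d i) (hs : ∀ j, 0 ≤ s j) (ha : ∀ i, 0 ≤ a i) (hb : ∀ j, 0 ≤ b j)
    (hw : ∀ i j, w i j ≤ a i + b j) :
    Phi w d s ≤ (∑ i, a i * d i) + ∑ j, b j * s j := by
  refine csSup_le ⟨_, fun _ _ => 0, ⟨fun _ _ => le_rfl, ?_, ?_⟩, rfl⟩ ?_
  · simpa using hd
  · simpa using hs
  · rintro z ⟨y, hy, rfl⟩
    exact value_le_dual hy ha hb hw

theorem value_le_Phi {nd ns : ℕ} {w : Fin nd → Fin ns → ℝ} {d : Fin nd → ℝ}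
    {s : Fin ns → ℝ} {x : Fin nd → Fin ns → ℝ} {a : Fin nd → ℝ} {b : Fin ns → ℝ}
    (hx : CEfeasible d s x) (ha : ∀ i, 0 ≤ a i) (hb : ∀ j, 0 ≤ b j)
    (hw : ∀ i j, w i j ≤ a i + b j) :
    ∑ i, ∑ j, w i j * x i j ≤ Phi w d s := by
  refine le_csSup ⟨(∑ i, a i * d i) + ∑ j, b j * s j, ?_⟩ ⟨x, hx, rfl⟩
  rintro z ⟨y, hy, rfl⟩
  exact value_le_dual hy ha hb hw

/-- The value matched to a demand type at an optimum is at least its shadow value. -/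
theorem dual_mul_demand_le_row_value {nd ns : ℕ} {w : Fin nd → Fin ns → ℝ} {d : Fin nd → ℝ}
    {s : Fin ns → ℝ} {x : Fin nd → Fin ns → ℝ} {a : Fin nd → ℝ} {b : Fin ns → ℝ}
    (hx : IsOptimal w d s x) (hab : IsOptimalDual w d s a b) (i : Fin nd) :
    a i * d i ≤ ∑ j, w i j * x i j := by
  obtain ⟨hf, hval⟩ := hx
  obtain ⟨ha, hb, hw, hdual⟩ := hab
  have hrow := row_value_le_dual hf ha hw
  have hgap := Finset.single_le_sum
    (f := fun i => a i * d i + ∑ j, b j * x i j - ∑ j, w i j * x i j)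
    (fun i _ => sub_nonneg.2 (hrow i)) (Finset.mem_univ i)
  simp only [Finset.sum_sub_distrib, Finset.sum_add_distrib] at hgap
  have hnn : 0 ≤ ∑ j, b j * x i j :=
    Finset.sum_nonneg fun j _ => mul_nonneg (hb j) (hf.1 i j)
  linarith [sum_supply_price_le hf hb]

/-- Scaling the rows of a feasible solution down to a smaller demand keeps it feasible. -/
theorem CEfeasible.scale_rows {nd ns : ℕ} {d d' : Fin nd → ℝ} {s : Fin ns → ℝ}
    {x : Fin nd → Fin ns → ℝ} (hx : CEfeasible d s x) (hd : ∀ i, 0 < d i)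
    (hd' : ∀ i, 0 ≤ d' i) (hle : ∀ i, d' i ≤ d i) :
    CEfeasible d' s (fun i j => d' i / d i * x i j) := by
  have hr : ∀ i, 0 ≤ d' i / d i := fun i => div_nonneg (hd' i) (hd i).le
  refine ⟨fun i j => mul_nonneg (hr i) (hx.1 i j), fun i => ?_, fun j => ?_⟩
  · rw [← Finset.mul_sum]
    exact (mul_le_mul_of_nonneg_left (hx.2.1 i) (hr i)).trans_eq
      (div_mul_cancel₀ _ (hd i).ne')
  · exact (Finset.sum_le_sum fun i _ => mul_le_of_le_one_left (hx.1 i j)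
      ((div_le_one (hd i)).2 (hle i))).trans (hx.2.2 j)

/-- for proportional cost, if `ρ ≤ (1-α)/(2-α)`, the cost-excluded
shadow price estimator reduces bias compared to the RCT estimator. -/
theorem sp_ce_reduces_bias_prop (nd ns : ℕ) (hnd : 0 < nd) (hns : 0 < ns)
    (v : Fin nd → Fin ns → ℝ)
    (lam beta : Fin nd → ℝ) (gam : Fin ns → ℝ)
    (hlam : ∀ i, 0 ≤ lam i) (hbeta : ∀ i, 0 ≤ beta i) (hgam : ∀ j, 0 ≤ gam j)
    (alpha : ℝ) (halpha0 : 0 ≤ alpha) (halpha1 : alpha < 1)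
    (rho : ℝ) (hrho0 : 0 < rho) (hrho : rho ≤ (1 - alpha) / (2 - alpha))
    (hpos : ∀ i, 0 < lam i + rho * beta i)
    (x : Fin nd → Fin ns → ℝ)
    (hx : IsOptimal v (fun i => lam i + rho * beta i) gam x)
    (a : Fin nd → ℝ) (b : Fin ns → ℝ)
    (hab : IsOptimalDual v (fun i => lam i + rho * beta i) gam a b)
    (vbar : Fin nd → ℝ)
    (hvbar : ∀ i, vbar i = (∑ j, v i j * x i j) / (lam i + rho * beta i))
    (Delta hatRCT hatSP : ℝ)
    (hDelta : Delta = (1 - alpha) * Phi v (fun i => lam i + beta i) gam - Phi v lam gam)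
    (hRCT : hatRCT = (1 - alpha) * (∑ i, vbar i * (lam i + beta i)) - ∑ i, vbar i * lam i)
    (hSP : hatSP = (∑ i, a i * beta i)
      - alpha * ((∑ i, a i * (lam i + beta i)) + ∑ j, b j * gam j)) :
    |hatSP - Delta| ≤ hatRCT - Delta := by
  have ⟨ha, hb, hw, hdual⟩ := hab
  have hPhi1 : Phi v (fun i => lam i + beta i) gam
      ≤ (∑ i, a i * (lam i + beta i)) + ∑ j, b j * gam j :=
    Phi_le_dual (fun i => add_nonneg (hlam i) (hbeta i)) hgam ha hb hw
  have hPhi0 : ∑ i, vbar i * lam i ≤ Phi v lam gam := by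
    have h := value_le_Phi (hx.1.scale_rows hpos hlam fun i =>
      le_add_of_nonneg_right (mul_nonneg hrho0.le (hbeta i))) ha hb hw
    refine le_trans (le_of_eq (Finset.sum_congr rfl fun i _ => ?_)) h
    rw [hvbar, div_mul_eq_mul_div, mul_div_assoc, Finset.sum_mul]
    exact Finset.sum_congr rfl fun j _ => by ring
  have hPhiRho : ∑ i, vbar i * (lam i + rho * beta i)
      = Phi v (fun i => lam i + rho * beta i) gam := by
    rw [← hx.2]
    refine Finset.sum_congr rfl fun i _ => ?_
    rw [hvbar, div_mul_cancel₀ _ (hpos i).ne']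
  have hslope : ∑ i, a i * beta i ≤ ∑ i, vbar i * beta i := by
    refine Finset.sum_le_sum fun i _ => mul_le_mul_of_nonneg_right ?_ (hbeta i)
    rw [hvbar, le_div_iff₀ (hpos i)]
    exact dual_mul_demand_le_row_value hx hab i
  have hrho' : rho ≤ (1 - alpha) * (1 - rho) := by
    rw [le_div_iff₀ (by linarith)] at hrho
    linarith
  have hlin : ∀ c : Fin nd → ℝ, ∑ i, c i * (lam i + rho * beta i)
      = (∑ i, c i * lam i) + rho * ∑ i, c i * beta i := fun c => by
    rw [Finset.mul_sum, ← Finset.sum_add_distrib]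
    exact Finset.sum_congr rfl fun i _ => by ring
  rw [hlin] at hPhiRho hdual
  simp only [mul_add, Finset.sum_add_distrib] at hPhi1 hRCT hSP
  set D := ∑ i, a i * beta i
  set r := ∑ i, vbar i * beta i
  set A := ∑ i, a i * lam i
  set R := ∑ i, vbar i * lam i
  set B := ∑ j, b j * gam j
  have hR : R = A + B + rho * D - rho * r := by linarith
  have hgap : rho * (r - D) ≤ (1 - alpha) * (1 - rho) * (r - D) :=
    mul_le_mul_of_nonneg_right hrho' (sub_nonneg.2 hslope)
  have hnn : 0 ≤ rho * (r - D) := mul_nonneg hrho0.le (sub_nonneg.2 hslope)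
  have hPhi1' := mul_le_mul_of_nonneg_left hPhi1 (sub_nonneg.2 halpha1.le)
  rw [hR] at hPhi0 hRCT
  rw [abs_le]
  constructor <;> subst hDelta hRCT hSP <;> linarith
end

section
/- Suppose v_{i,j} > 0 for all i,j, 0 < α ≤ 1/2, v^tre = (1−α)v, and for each supply type j there is a demand type i(j) with v_{i(j),j} > v_{k,j} for every k ≠ i(j). Let λ, β ∈ ℝ^{n_d} and γ ∈ ℝ^{n_s} be nonnegative with λ_i > 0 for all i, let 0 < ρ < 1, and assume Σ_j γ_j < (1−ρ)·λ_i for every i. Let (a^con, a^tre, b) be any optimal CI dual for ((1−ρ)λ, ρ(λ+β), γ), and let (x^con, x^tre) be any optimal CI-feasible solution of the same problem. Then a^con = 0 and a^tre = 0, so the shadow price estimator Δ̂_SP = a^tre·(λ+β) − a^con·λ equals 0, and its bias relative to Δ = Φ_CI(0, λ+β, γ) − Φ_CI(λ, 0, γ) satisfies |Δ̂_SP − Δ| ≤ |Δ̂_RCT − Δ|, where Δ̂_RCT = (1/ρ)·Σ_{i,j} (1−α)v_{i,j} x^tre_{i,j} − (1/(1−ρ))·Σ_{i,j} v_{i,j}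 x^con_{i,j}. -/
/-- A pair `(xcon, xtre)` is CI-feasible for `(dcon, dtre, s)`. -/
def CIfeasible {nd ns : ℕ} (dcon dtre : Fin nd → ℝ) (s : Fin ns → ℝ)
    (xcon xtre : Fin nd → Fin ns → ℝ) : Prop :=
  (∀ i j, 0 ≤ xcon i j) ∧ (∀ i j, 0 ≤ xtre i j) ∧
  (∀ i, ∑ j, xcon i j ≤ dcon i) ∧ (∀ i, ∑ j, xtre i j ≤ dtre i) ∧
  (∀ j, ∑ i, (xcon i j + xtre i j) ≤ s j)

/-- The cost-included matching value `Φ_CI(dcon, dtre, s)`. -/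
noncomputable def PhiCI {nd ns : ℕ} (v vtre : Fin nd → Fin ns → ℝ)
    (dcon dtre : Fin nd → ℝ) (s : Fin ns → ℝ) : ℝ :=
  sSup {z : ℝ | ∃ xcon xtre, CIfeasible dcon dtre s xcon xtre ∧
    z = ∑ i, ∑ j, (v i j * xcon i j + vtre i j * xtre i j)}

/-- `(xcon, xtre)` is an optimal CI-feasible solution for `(dcon, dtre, s)`. -/
def CIOptimal {nd ns : ℕ} (v vtre : Fin nd → Fin ns → ℝ)
    (dcon dtre : Fin nd → ℝ) (s : Fin ns → ℝ)
    (xcon xtre : Fin nd → Fin ns → ℝ) : Prop :=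
  CIfeasible dcon dtre s xcon xtre ∧
  ∑ i, ∑ j, (v i j * xcon i j + vtre i j * xtre i j) = PhiCI v vtre dcon dtre s

/-- `(acon, atre, b)` is an optimal CI dual for `(dcon, dtre, s)`. -/
def CIOptimalDual {nd ns : ℕ} (v vtre : Fin nd → Fin ns → ℝ)
    (dcon dtre : Fin nd → ℝ) (s : Fin ns → ℝ)
    (acon atre : Fin nd → ℝ) (b : Fin ns → ℝ) : Prop :=
  (∀ i, 0 ≤ acon i) ∧ (∀ i, 0 ≤ atre i) ∧ (∀ j, 0 ≤ b j) ∧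
  (∀ i j, v i j ≤ acon i + b j) ∧ (∀ i j, vtre i j ≤ atre i + b j) ∧
  (∑ i, acon i * dcon i) + (∑ i, atre i * dtre i) + (∑ j, b j * s j) =
    PhiCI v vtre dcon dtre s

/-- Reduced costs plus primal value are bounded by the dual value. -/
theorem CIfeasible.slack_add_value_le {nd ns : ℕ} {v vtre : Fin nd → Fin ns → ℝ}
    {dcon dtre : Fin nd → ℝ} {s : Fin ns → ℝ} {xcon xtre : Fin nd → Fin ns → ℝ}
    (hx : CIfeasible dcon dtre s xcon xtre)
    {acon atre : Fin nd → ℝ} {b : Fin ns → ℝ}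
    (hac : ∀ i, 0 ≤ acon i) (hat : ∀ i, 0 ≤ atre i) (hb : ∀ j, 0 ≤ b j) :
    (∑ i, ∑ j, ((acon i + b j - v i j) * xcon i j + (atre i + b j - vtre i j) * xtre i j)) +
      (∑ i, ∑ j, (v i j * xcon i j + vtre i j * xtre i j)) ≤
    (∑ i, acon i * dcon i) + (∑ i, atre i * dtre i) + ∑ j, b j * s j := by
  obtain ⟨-, -, hcon, htre, hs⟩ := hx
  have key : (∑ i, ∑ j, ((acon i + b j - v i j) * xcon i j +
        (atre i + b j - vtre i j) * xtre i j)) +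
      (∑ i, ∑ j, (v i j * xcon i j + vtre i j * xtre i j)) =
      (∑ i, acon i * ∑ j, xcon i j) + (∑ i, atre i * ∑ j, xtre i j) +
        ∑ j, b j * ∑ i, (xcon i j + xtre i j) := by
    simp only [Finset.mul_sum]
    rw [Finset.sum_comm (f := fun j i => b j * (xcon i j + xtre i j))]
    simp only [← Finset.sum_add_distrib]
    refine Finset.sum_congr rfl fun i _ => Finset.sum_congr rfl fun j _ => ?_
    ring
  rw [key]
  gcongr with i _ i _ j _
  · exact hac i
  · exact hcon i
  · exact hat i
  · exact htre i
  · exact hb j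
  · exact hs j

/-- Weak duality. -/
theorem CIfeasible.value_le {nd ns : ℕ} {v vtre : Fin nd → Fin ns → ℝ}
    {dcon dtre : Fin nd → ℝ} {s : Fin ns → ℝ} {xcon xtre : Fin nd → Fin ns → ℝ}
    (hx : CIfeasible dcon dtre s xcon xtre)
    {acon atre : Fin nd → ℝ} {b : Fin ns → ℝ}
    (hac : ∀ i, 0 ≤ acon i) (hat : ∀ i, 0 ≤ atre i) (hb : ∀ j, 0 ≤ b j)
    (hcon : ∀ i j, v i j ≤ acon i + b j) (htre : ∀ i j, vtre i j ≤ atre i + b j) :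
    ∑ i, ∑ j, (v i j * xcon i j + vtre i j * xtre i j) ≤
    (∑ i, acon i * dcon i) + (∑ i, atre i * dtre i) + ∑ j, b j * s j := by
  have h := hx.slack_add_value_le (v := v) (vtre := vtre) hac hat hb
  have hslack : 0 ≤ ∑ i, ∑ j, ((acon i + b j - v i j) * xcon i j +
      (atre i + b j - vtre i j) * xtre i j) :=
    Finset.sum_nonneg fun i _ => Finset.sum_nonneg fun j _ =>
      add_nonneg (mul_nonneg (sub_nonneg.2 (hcon i j)) (hx.1 i j))
        (mul_nonneg (sub_nonneg.2 (htre i j)) (hx.2.1 i j))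
  linarith

/-- A feasible pair and a dual feasible triple with the same value certify `PhiCI`. -/
theorem PhiCI_eq_of_dual {nd ns : ℕ} {v vtre : Fin nd → Fin ns → ℝ}
    {dcon dtre : Fin nd → ℝ} {s : Fin ns → ℝ} {xcon xtre : Fin nd → Fin ns → ℝ}
    (hx : CIfeasible dcon dtre s xcon xtre)
    {acon atre : Fin nd → ℝ} {b : Fin ns → ℝ}
    (hac : ∀ i, 0 ≤ acon i) (hat : ∀ i, 0 ≤ atre i) (hb : ∀ j, 0 ≤ b j)
    (hcon : ∀ i j, v i j ≤ acon i + b j) (htre : ∀ i j, vtre i j ≤ atre i + b j)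
    (heq : ∑ i, ∑ j, (v i j * xcon i j + vtre i j * xtre i j) =
      (∑ i, acon i * dcon i) + (∑ i, atre i * dtre i) + ∑ j, b j * s j) :
    PhiCI v vtre dcon dtre s =
      (∑ i, acon i * dcon i) + (∑ i, atre i * dtre i) + ∑ j, b j * s j := by
  refine IsGreatest.csSup_eq ⟨⟨xcon, xtre, hx, heq.symm⟩, ?_⟩
  rintro z ⟨ycon, ytre, hy, rfl⟩
  exact hy.value_le hac hat hb hcon htre

/-- The assignment sending all supply of type `j` to demand type `f j`. -/
def assignAll {nd ns : ℕ} (f : Fin ns → Fin nd) (s : Fin ns → ℝ) : Fin nd → Fin ns → ℝ :=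
  fun i j => if i = f j then s j else 0

theorem assignAll_nonneg {nd ns : ℕ} (f : Fin ns → Fin nd) {s : Fin ns → ℝ}
    (hs : ∀ j, 0 ≤ s j) (i : Fin nd) (j : Fin ns) : 0 ≤ assignAll f s i j := by
  unfold assignAll
  split_ifs
  exacts [hs j, le_rfl]

theorem sum_assignAll_le {nd ns : ℕ} (f : Fin ns → Fin nd) {s : Fin ns → ℝ}
    (hs : ∀ j, 0 ≤ s j) (i : Fin nd) : ∑ j, assignAll f s i j ≤ ∑ j, s j := by
  refine Finset.sum_le_sum fun j _ => ?_
  unfold assignAll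
  split_ifs
  exacts [le_rfl, hs j]

theorem sum_assignAll {nd ns : ℕ} (f : Fin ns → Fin nd) (s : Fin ns → ℝ) (j : Fin ns) :
    ∑ i, assignAll f s i j = s j := by
  simp [assignAll]

theorem sum_mul_assignAll {nd ns : ℕ} (f : Fin ns → Fin nd) (s : Fin ns → ℝ)
    (w : Fin nd → Fin ns → ℝ) :
    ∑ i, ∑ j, w i j * assignAll f s i j = ∑ j, w (f j) j * s j := by
  rw [Finset.sum_comm]
  simp [assignAll]

/-- If the control demand of each type exceeds the total supply and control weights dominate, all
supply is matched to its best demand type in control. -/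
theorem PhiCI_eq_of_control_abundant {nd ns : ℕ} {v vtre : Fin nd → Fin ns → ℝ}
    {dcon dtre : Fin nd → ℝ} {s : Fin ns → ℝ} {f : Fin ns → Fin nd}
    (hv : ∀ i j, v i j ≤ v (f j) j) (hvtre : ∀ i j, vtre i j ≤ v (f j) j)
    (hpos : ∀ j, 0 ≤ v (f j) j) (hs : ∀ j, 0 ≤ s j)
    (hdcon : ∀ i, ∑ j, s j ≤ dcon i) (hdtre : ∀ i, 0 ≤ dtre i) :
    PhiCI v vtre dcon dtre s = ∑ j, v (f j) j * s j := by
  have hx : CIfeasible dcon dtre s (assignAll f s) 0 := by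
    refine ⟨assignAll_nonneg f hs, by simp,
      fun i => (sum_assignAll_le f hs i).trans (hdcon i), by simpa using hdtre, fun j => ?_⟩
    simp [sum_assignAll]
  rw [PhiCI_eq_of_dual (v := v) (vtre := vtre) (acon := 0) (atre := 0)
    (b := fun j => v (f j) j) hx (by simp) (by simp) hpos (by simpa using hv)
    (by simpa using hvtre) (by simp [sum_mul_assignAll])]
  simp

/-- With no control demand and treatment demand of each type exceeding the total supply, all
supply is matched to its best demand type in treatment. -/
theorem PhiCI_eq_of_treatment_abundant {nd ns : ℕ} {v vtre : Fin nd → Fin ns → ℝ}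
    {dtre : Fin nd → ℝ} {s : Fin ns → ℝ} {f : Fin ns → Fin nd}
    (hvtre : ∀ i j, vtre i j ≤ vtre (f j) j)
    (hpos : ∀ j, 0 ≤ vtre (f j) j) (hs : ∀ j, 0 ≤ s j)
    (hdtre : ∀ i, ∑ j, s j ≤ dtre i) :
    PhiCI v vtre (fun _ => 0) dtre s = ∑ j, vtre (f j) j * s j := by
  have hx : CIfeasible (fun _ => 0) dtre s 0 (assignAll f s) := by
    refine ⟨by simp, assignAll_nonneg f hs, by simp,
      fun i => (sum_assignAll_le f hs i).trans (hdtre i), fun j => ?_⟩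
    simp [sum_assignAll]
  have hcon (i : Fin nd) (j : Fin ns) : v i j ≤ (∑ k, |v i k|) + vtre (f j) j := by
    have := Finset.single_le_sum (f := fun k => |v i k|) (fun k _ => abs_nonneg _)
      (Finset.mem_univ j)
    linarith [le_abs_self (v i j), hpos j]
  rw [PhiCI_eq_of_dual (v := v) (vtre := vtre) (acon := fun i => ∑ k, |v i k|) (atre := 0)
    (b := fun j => vtre (f j) j) hx (fun i => Finset.sum_nonneg fun k _ => abs_nonneg _)
    (by simp) hpos hcon (by simpa using hvtre) (by simp [sum_mul_assignAll])]
  simp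

/-- When each control demand strictly exceeds the total supply and the value is that of matching
all supply in control, every optimal dual has vanishing demand prices. -/
theorem CIOptimalDual.demand_prices_eq_zero {nd ns : ℕ} {v vtre : Fin nd → Fin ns → ℝ}
    {dcon dtre : Fin nd → ℝ} {s : Fin ns → ℝ} {f : Fin ns → Fin nd}
    {acon atre : Fin nd → ℝ} {b : Fin ns → ℝ}
    (h : CIOptimalDual v vtre dcon dtre s acon atre b)
    (hPhi : PhiCI v vtre dcon dtre s = ∑ j, v (f j) j * s j) (hs : ∀ j, 0 ≤ s j)
    (hdcon : ∀ i, ∑ j, s j < dcon i) (hdtre : ∀ i, 0 < dtre i) :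
    (∀ i, acon i = 0) ∧ (∀ i, atre i = 0) := by
  obtain ⟨hac, hat, -, hcon, -, heq⟩ := h
  have hsupply : ∑ j, v (f j) j * s j ≤ (∑ j, acon (f j) * s j) + ∑ j, b j * s j := by
    rw [← Finset.sum_add_distrib]
    refine Finset.sum_le_sum fun j _ => ?_
    rw [← add_mul]
    exact mul_le_mul_of_nonneg_right (hcon _ j) (hs j)
  have hassign : ∑ j, acon (f j) * s j ≤ ∑ i, acon i * ∑ j, s j := by
    rw [← sum_mul_assignAll f s (fun i _ => acon i)]
    simp only [← Finset.mul_sum]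
    exact Finset.sum_le_sum fun i _ =>
      mul_le_mul_of_nonneg_left (sum_assignAll_le f hs i) (hac i)
  have hexcess : ∑ i, acon i * (dcon i - ∑ j, s j) =
      (∑ i, acon i * dcon i) - ∑ i, acon i * ∑ j, s j := by
    simp only [mul_sub, Finset.sum_sub_distrib]
  have hcon_nonneg (i : Fin nd) : 0 ≤ acon i * (dcon i - ∑ j, s j) :=
    mul_nonneg (hac i) (sub_nonneg.2 (hdcon i).le)
  have htre_nonneg (i : Fin nd) : 0 ≤ atre i * dtre i := mul_nonneg (hat i) (hdtre i).le
  have hcon_sum := Finset.sum_nonneg fun i (_ : i ∈ Finset.univ) => hcon_nonneg i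
  have htre_sum := Finset.sum_nonneg fun i (_ : i ∈ Finset.univ) => htre_nonneg i
  have hcon_zero : ∑ i, acon i * (dcon i - ∑ j, s j) = 0 := by linarith
  have htre_zero : ∑ i, atre i * dtre i = 0 := by linarith
  rw [Finset.sum_eq_zero_iff_of_nonneg fun i _ => hcon_nonneg i] at hcon_zero
  rw [Finset.sum_eq_zero_iff_of_nonneg fun i _ => htre_nonneg i] at htre_zero
  exact ⟨fun i => (mul_eq_zero.1 (hcon_zero i (Finset.mem_univ i))).resolve_right
      (sub_pos.2 (hdcon i)).ne',
    fun i => (mul_eq_zero.1 (htre_zero i (Finset.mem_univ i))).resolve_right (hdtre i).ne'⟩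

/-- If treatment weights are strictly dominated by the price vector `b` attaining the value,
optimal solutions do not match in treatment. -/
theorem CIOptimal.treatment_eq_zero {nd ns : ℕ} {v vtre : Fin nd → Fin ns → ℝ}
    {dcon dtre : Fin nd → ℝ} {s b : Fin ns → ℝ} {xcon xtre : Fin nd → Fin ns → ℝ}
    (h : CIOptimal v vtre dcon dtre s xcon xtre)
    (hPhi : PhiCI v vtre dcon dtre s = ∑ j, b j * s j) (hb : ∀ j, 0 ≤ b j)
    (hv : ∀ i j, v i j ≤ b j) (hvtre : ∀ i j, vtre i j < b j) (i : Fin nd) (j : Fin ns) :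
    xtre i j = 0 := by
  obtain ⟨hx, hval⟩ := h
  have hle := hx.slack_add_value_le (v := v) (vtre := vtre) (acon := 0) (atre := 0)
    (fun _ => le_rfl) (fun _ => le_rfl) hb
  simp only [Pi.zero_apply, zero_add, zero_mul, Finset.sum_const_zero, hval, hPhi] at hle
  have hcon_nonneg (i : Fin nd) (j : Fin ns) : 0 ≤ (b j - v i j) * xcon i j :=
    mul_nonneg (sub_nonneg.2 (hv i j)) (hx.1 i j)
  have htre_nonneg (i : Fin nd) (j : Fin ns) : 0 ≤ (b j - vtre i j) * xtre i j :=
    mul_nonneg (sub_nonneg.2 (hvtre i j).le) (hx.2.1 i j)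
  have hterm (i : Fin nd) (j : Fin ns) := add_nonneg (hcon_nonneg i j) (htre_nonneg i j)
  have hrow := Finset.single_le_sum
    (fun i _ => Finset.sum_nonneg fun j (_ : j ∈ Finset.univ) => hterm i j) (Finset.mem_univ i)
  have hentry := Finset.single_le_sum (fun j _ => hterm i j) (Finset.mem_univ j)
  have hzero : (b j - vtre i j) * xtre i j = 0 :=
    le_antisymm (by linarith [hcon_nonneg i j]) (htre_nonneg i j)
  exact (mul_eq_zero.1 hzero).resolve_left (sub_pos.2 (hvtre i j)).ne'

/-- in the low-supply regime with proportional cost `α ≤ 1/2`, the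
cost-included shadow price estimator has zero demand duals and weakly smaller
bias than the RCT estimator. -/
theorem sp_ci_low_supply (nd ns : ℕ) (hnd : 0 < nd) (hns : 0 < ns)
    (v vtre : Fin nd → Fin ns → ℝ) (hv : ∀ i j, 0 < v i j)
    (alpha : ℝ) (halpha0 : 0 < alpha) (halpha1 : alpha ≤ 1 / 2)
    (hvtre : ∀ i j, vtre i j = (1 - alpha) * v i j)
    (ic : Fin ns → Fin nd)
    (hic : ∀ j, ∀ k, k ≠ ic j → v k j < v (ic j) j)
    (lam beta : Fin nd → ℝ) (gam : Fin ns → ℝ)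
    (hlam : ∀ i, 0 < lam i) (hbeta : ∀ i, 0 ≤ beta i) (hgam : ∀ j, 0 ≤ gam j)
    (rho : ℝ) (hrho0 : 0 < rho) (hrho1 : rho < 1)
    (hlow : ∀ i, ∑ j, gam j < (1 - rho) * lam i)
    (acon atre : Fin nd → ℝ) (b : Fin ns → ℝ)
    (hdual : CIOptimalDual v vtre (fun i => (1 - rho) * lam i)
      (fun i => rho * (lam i + beta i)) gam acon atre b)
    (xcon xtre : Fin nd → Fin ns → ℝ)
    (hopt : CIOptimal v vtre (fun i => (1 - rho) * lam i)
      (fun i => rho * (lam i + beta i)) gam xcon xtre)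
    (Delta hatRCT hatSP : ℝ)
    (hDelta : Delta = PhiCI v vtre (fun _ => 0) (fun i => lam i + beta i) gam
      - PhiCI v vtre lam (fun _ => 0) gam)
    (hRCT : hatRCT = (1 / rho) * (∑ i, ∑ j, (1 - alpha) * v i j * xtre i j)
      - (1 / (1 - rho)) * (∑ i, ∑ j, v i j * xcon i j))
    (hSP : hatSP = (∑ i, atre i * (lam i + beta i)) - ∑ i, acon i * lam i) :
    (∀ i, acon i = 0) ∧ (∀ i, atre i = 0) ∧ hatSP = 0 ∧
    |hatSP - Delta| ≤ |hatRCT - Delta| := by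
  have hmax (i : Fin nd) (j : Fin ns) : v i j ≤ v (ic j) j := by
    rcases eq_or_ne i (ic j) with rfl | h
    exacts [le_rfl, (hic j i h).le]
  have htre_lt (i : Fin nd) (j : Fin ns) : vtre i j < v (ic j) j := by
    rw [hvtre]
    nlinarith [hmax i j, mul_pos halpha0 (hv i j)]
  have hpos (j : Fin ns) : 0 ≤ v (ic j) j := (hv _ j).le
  have hlow' (i : Fin nd) : ∑ j, gam j ≤ lam i := by
    nlinarith [hlow i, mul_pos hrho0 (hlam i)]
  have hdtre (i : Fin nd) : 0 < rho * (lam i + beta i) :=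
    mul_pos hrho0 (add_pos_of_pos_of_nonneg (hlam i) (hbeta i))
  have hPhi := PhiCI_eq_of_control_abundant hmax (fun i j => (htre_lt i j).le) hpos hgam
    (fun i => (hlow i).le) (fun i => (hdtre i).le)
  have hPhi_con := PhiCI_eq_of_control_abundant (dtre := fun _ => 0) hmax
    (fun i j => (htre_lt i j).le) hpos hgam hlow' (fun _ => le_rfl)
  have hPhi_tre : PhiCI v vtre (fun _ => 0) (fun i => lam i + beta i) gam =
      (1 - alpha) * ∑ j, v (ic j) j * gam j := by
    rw [PhiCI_eq_of_treatment_abundant (f := ic) (fun i j => ?_) (fun j => ?_) hgam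
      (fun i => (hlow' i).trans (le_add_of_nonneg_right (hbeta i)))]
    · simp only [hvtre, Finset.mul_sum, mul_assoc]
    · rw [hvtre, hvtre]
      exact mul_le_mul_of_nonneg_left (hmax i j) (by linarith)
    · rw [hvtre]
      exact mul_nonneg (by linarith) (hpos j)
  obtain ⟨hacon, hatre⟩ := hdual.demand_prices_eq_zero hPhi hgam hlow hdtre
  have hxtre := hopt.treatment_eq_zero hPhi hpos hmax htre_lt
  have hSP_zero : hatSP = 0 := by simp [hSP, hacon, hatre]
  refine ⟨hacon, hatre, hSP_zero, ?_⟩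
  have hval := hopt.2
  rw [hPhi] at hval
  simp only [hxtre, mul_zero, add_zero] at hval
  simp only [hxtre, mul_zero, Finset.sum_const_zero, zero_sub, hval] at hRCT
  rw [hPhi_tre, hPhi_con] at hDelta
  have hV : 0 ≤ ∑ j, v (ic j) j * gam j :=
    Finset.sum_nonneg fun j _ => mul_nonneg (hpos j) (hgam j)
  generalize ∑ j, v (ic j) j * gam j = V at hV hRCT hDelta
  have hscale : 1 ≤ 1 / (1 - rho) := one_le_one_div (by linarith) (by linarith)
  have hSP_sub : hatSP - Delta = alpha * V := by rw [hSP_zero, hDelta]; ring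
  rw [hSP_sub, abs_of_nonneg (mul_nonneg halpha0.le hV)]
  refine le_trans ?_ (neg_le_abs _)
  rw [hRCT, hDelta]
  nlinarith [mul_le_mul_of_nonneg_right hscale hV, mul_le_mul_of_nonneg_right halpha1 hV]
end

section
/- Suppose v_{i,j} > 0 for all i,j, let 0 ≤ κ < min_{i,j} v_{i,j}, and let v−κ denote the weight matrix with entries v_{i,j} − κ. For any nonnegative d ∈ ℝ^{n_d} and s ∈ ℝ^{n_s}: a CE-feasible matrix x is v-optimal for (d,s) if and only if it is (v−κ)-optimal for (d,s), and Φ_{v−κ}(d,s) = Φ_v(d,s) − κ·min(Σ_i d_i, Σ_j s_j). -/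
namespace CEfeasible

variable {nd ns : ℕ} {d : Fin nd → ℝ} {s : Fin ns → ℝ} {x : Fin nd → Fin ns → ℝ}

theorem sum_le_min (hx : CEfeasible d s x) :
    ∑ i, ∑ j, x i j ≤ min (∑ i, d i) (∑ j, s j) := by
  refine le_min (Finset.sum_le_sum fun i _ => hx.2.1 i) ?_
  rw [Finset.sum_comm]
  exact Finset.sum_le_sum fun j _ => hx.2.2 j

/-- Every feasible matrix is dominated entrywise by one of the largest possible total mass. -/
theorem exists_le_sum_eq_min (hx : CEfeasible d s x) :
    ∃ y, CEfeasible d s y ∧ (∀ i j, x i j ≤ y i j) ∧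
      ∑ i, ∑ j, y i j = min (∑ i, d i) (∑ j, s j) := by
  obtain ⟨h0, h1, h2⟩ := hx
  set r : Fin nd → ℝ := fun i => d i - ∑ j, x i j with hr
  set c : Fin ns → ℝ := fun j => s j - ∑ i, x i j with hc
  have hr0 : ∀ i, 0 ≤ r i := fun i => sub_nonneg.2 (h1 i)
  have hc0 : ∀ j, 0 ≤ c j := fun j => sub_nonneg.2 (h2 j)
  set R := ∑ i, r i with hR
  set C := ∑ j, c j with hC
  have hR0 : 0 ≤ R := Finset.sum_nonneg fun i _ => hr0 i
  have hC0 : 0 ≤ C := Finset.sum_nonneg fun j _ => hc0 j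
  have hm0 : 0 ≤ max R C := le_max_of_le_left hR0
  have hRd : ∑ i, d i = R + ∑ i, ∑ j, x i j := by
    simp [hR, hr, Finset.sum_sub_distrib]
  have hCs : ∑ j, s j = C + ∑ i, ∑ j, x i j := by
    rw [Finset.sum_comm]
    simp [hC, hc, Finset.sum_sub_distrib]
  have hrow : ∀ i, ∑ j, r i * c j / max R C = r i * (C / max R C) := fun i => by
    rw [← Finset.sum_div, ← Finset.mul_sum, mul_div_assoc]
  have hcol : ∀ j, ∑ i, r i * c j / max R C = c j * (R / max R C) := fun j => by
    rw [← Finset.sum_div, ← Finset.sum_mul, mul_comm, mul_div_assoc]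
  have hadd : ∀ i j, 0 ≤ r i * c j / max R C := fun i j =>
    div_nonneg (mul_nonneg (hr0 i) (hc0 j)) hm0
  refine ⟨fun i j => x i j + r i * c j / max R C, ⟨fun i j => add_nonneg (h0 i j) (hadd i j),
    fun i => ?_, fun j => ?_⟩, fun i j => le_add_of_nonneg_right (hadd i j), ?_⟩
  · rw [Finset.sum_add_distrib, hrow]
    have := mul_le_of_le_one_right (hr0 i) (div_le_one_of_le₀ (le_max_right R C) hm0)
    simp only [hr] at this ⊢
    linarith
  · rw [Finset.sum_add_distrib, hcol]
    have := mul_le_of_le_one_right (hc0 j) (div_le_one_of_le₀ (le_max_left R C) hm0)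
    simp only [hc] at this ⊢
    linarith
  · have hRC : R * (C / max R C) = min R C := by
      rcases hm0.eq_or_lt with h | h
      · have hRz : R = 0 := le_antisymm ((le_max_left R C).trans h.ge) hR0
        rw [hRz, zero_mul, min_eq_left hC0]
      · rw [← mul_div_assoc, div_eq_iff h.ne', min_mul_max]
    simp only [Finset.sum_add_distrib, hrow]
    rw [← Finset.sum_mul, hRC, hRd, hCs, min_add_add_right, add_comm]

theorem value_le_Phi (w : Fin nd → Fin ns → ℝ) (hx : CEfeasible d s x) :
    ∑ i, ∑ j, w i j * x i j ≤ Phi w d s := by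
  refine le_csSup ⟨∑ i, ∑ j, |w i j| * d i, ?_⟩ ⟨x, hx, rfl⟩
  rintro _ ⟨y, hy, rfl⟩
  refine Finset.sum_le_sum fun i _ => Finset.sum_le_sum fun j _ => ?_
  have hyd : y i j ≤ d i :=
    (Finset.single_le_sum (fun k _ => hy.1 i k) (Finset.mem_univ j)).trans (hy.2.1 i)
  exact mul_le_mul (le_abs_self _) hyd (hy.1 i j) (abs_nonneg _)

end CEfeasible

theorem Phi_le {nd ns : ℕ} {w : Fin nd → Fin ns → ℝ} {d : Fin nd → ℝ} {s : Fin ns → ℝ}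
    (hd : ∀ i, 0 ≤ d i) (hs : ∀ j, 0 ≤ s j) {b : ℝ}
    (h : ∀ x, CEfeasible d s x → ∑ i, ∑ j, w i j * x i j ≤ b) : Phi w d s ≤ b := by
  refine csSup_le ⟨_, 0, ⟨by simp, by simpa using hd, by simpa using hs⟩, rfl⟩ ?_
  rintro _ ⟨x, hx, rfl⟩
  exact h x hx

/-- With positive weights, an optimal matrix has the largest possible total mass. -/
theorem IsOptimal.sum_eq_min {nd ns : ℕ} {w : Fin nd → Fin ns → ℝ} {d : Fin nd → ℝ}
    {s : Fin ns → ℝ} {x : Fin nd → Fin ns → ℝ} (hw : ∀ i j, 0 < w i j)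
    (hx : IsOptimal w d s x) : ∑ i, ∑ j, x i j = min (∑ i, d i) (∑ j, s j) := by
  obtain ⟨y, hy, hxy, hsum⟩ := hx.1.exists_le_sum_eq_min
  suffices h : x = y by rw [h, hsum]
  by_contra hne
  obtain ⟨i, hi⟩ := Function.ne_iff.1 hne
  obtain ⟨j, hj⟩ := Function.ne_iff.1 hi
  have hle : ∀ i j, w i j * x i j ≤ w i j * y i j := fun i j =>
    mul_le_mul_of_nonneg_left (hxy i j) (hw i j).le
  have hlt : ∑ i, ∑ j, w i j * x i j < ∑ i, ∑ j, w i j * y i j :=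
    Finset.sum_lt_sum (fun i _ => Finset.sum_le_sum fun j _ => hle i j)
      ⟨i, Finset.mem_univ i, Finset.sum_lt_sum (fun j _ => hle i j) ⟨j, Finset.mem_univ j,
        mul_lt_mul_of_pos_left (lt_of_le_of_ne (hxy i j) hj) (hw i j)⟩⟩
  exact (hlt.trans_le (hy.value_le_Phi w)).ne hx.2

theorem sum_sub_const_mul {nd ns : ℕ} (v : Fin nd → Fin ns → ℝ) (κ : ℝ)
    (x : Fin nd → Fin ns → ℝ) :
    ∑ i, ∑ j, (v i j - κ) * x i j = ∑ i, ∑ j, v i j * x i j - κ * ∑ i, ∑ j, x i j := by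
  simp only [sub_mul, Finset.sum_sub_distrib, Finset.mul_sum]


/-- shifting all weights down by `κ < min v` preserves the
optimal matchings and shifts the value by `κ·min(total demand, total supply)`. -/
theorem shifted_weights_optimality (nd ns : ℕ) (hnd : 0 < nd) (hns : 0 < ns)
    (v : Fin nd → Fin ns → ℝ) (hv : ∀ i j, 0 < v i j)
    (kappa : ℝ) (hkappa0 : 0 ≤ kappa) (hkappa : ∀ i j, kappa < v i j)
    (d : Fin nd → ℝ) (s : Fin ns → ℝ)
    (hd : ∀ i, 0 ≤ d i) (hs : ∀ j, 0 ≤ s j) :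
    (∀ x : Fin nd → Fin ns → ℝ, CEfeasible d s x →
      (IsOptimal v d s x ↔ IsOptimal (fun i j => v i j - kappa) d s x)) ∧
    Phi (fun i j => v i j - kappa) d s =
      Phi v d s - kappa * min (∑ i, d i) (∑ j, s j) := by
  have hw : ∀ i j, 0 < v i j - kappa := fun i j => sub_pos.2 (hkappa i j)
  have hPhi : Phi (fun i j => v i j - kappa) d s =
      Phi v d s - kappa * min (∑ i, d i) (∑ j, s j) := by
    apply le_antisymm
    · refine Phi_le hd hs fun x hx => ?_
      obtain ⟨y, hy, hxy, hsum⟩ := hx.exists_le_sum_eq_min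
      calc ∑ i, ∑ j, (v i j - kappa) * x i j
          ≤ ∑ i, ∑ j, (v i j - kappa) * y i j :=
            Finset.sum_le_sum fun i _ => Finset.sum_le_sum fun j _ =>
              mul_le_mul_of_nonneg_left (hxy i j) (hw i j).le
        _ = ∑ i, ∑ j, v i j * y i j - kappa * min (∑ i, d i) (∑ j, s j) := by
            rw [sum_sub_const_mul, hsum]
        _ ≤ Phi v d s - kappa * min (∑ i, d i) (∑ j, s j) :=
            sub_le_sub_right (hy.value_le_Phi v) _
    · rw [sub_le_iff_le_add]
      refine Phi_le hd hs fun x hx => ?_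
      have h1 := hx.value_le_Phi fun i j => v i j - kappa
      have h2 := mul_le_mul_of_nonneg_left hx.sum_le_min hkappa0
      rw [sum_sub_const_mul] at h1
      linarith
  refine ⟨fun x hx => ⟨fun h => ⟨hx, ?_⟩, fun h => ⟨hx, ?_⟩⟩, hPhi⟩
  · rw [sum_sub_const_mul, h.sum_eq_min hv, hPhi, h.2]
  · have h1 := h.2
    rw [sum_sub_const_mul, h.sum_eq_min hw, hPhi] at h1
    exact sub_left_injective h1
end
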